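/- Let Ω ⊂ ℝ⁴ be open, λ > 0, and let v ∈ C²(Ω) be a convex function satisfying equation (★) on Ω. Then the Hessian ∇²v(x) has rank at least 2 for every x ∈ Ω. -/

import Mathlib

/-- First-order real partial derivative `∂f/∂xᵢ` on `ℝ⁴ ≅ ℂ²`. -/
noncomputable def pd (f : (Fin 4 → ℝ) → ℝ) (i : Fin 4) (x : Fin 4 → ℝ) : ℝ :=
  fderiv ℝ f x (Pi.single i 1)

/-- Second-order real partial derivative `∂²f/∂xᵢ∂xⱼ`. -/
noncomputable def pd2 (f : (Fin 4 → ℝ) → ℝ) (i j : Fin 4) (x : Fin 4 → ℝ) : ℝ :=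
  pd (fun y => pd f i y) j x

/-- The real Hessian matrix of `f` at `x`. -/
noncomputable def hessM (f : (Fin 4 → ℝ) → ℝ) (x : Fin 4 → ℝ) :
    Matrix (Fin 4) (Fin 4) ℝ :=
  Matrix.of fun i j => pd2 f i j x

/-- Equation (★) (indices 1,2,3,4 are `0,1,2,3`). -/
def StarEq (lam : ℝ) (v : (Fin 4 → ℝ) → ℝ) (Ω : Set (Fin 4 → ℝ)) : Prop :=
  ∀ x ∈ Ω,
    (pd2 v 0 0 x + pd2 v 2 2 x) * (pd2 v 1 1 x + pd2 v 3 3 x)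
      - (pd2 v 0 1 x + pd2 v 2 3 x)^2 - (pd2 v 0 3 x - pd2 v 1 2 x)^2
      - ((pd v 0 x)^2 + (pd v 2 x)^2) * (pd2 v 1 1 x + pd2 v 3 3 x)
      - ((pd v 1 x)^2 + (pd v 3 x)^2) * (pd2 v 0 0 x + pd2 v 2 2 x)
      + 2 * (pd v 0 x * pd v 1 x + pd v 2 x * pd v 3 x) * (pd2 v 0 1 x + pd2 v 2 3 x)
      + 2 * (pd v 0 x * pd v 3 x - pd v 1 x * pd v 2 x) * (pd2 v 0 3 x - pd2 v 1 2 x)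
      = lam

/-- Second partial derivatives are values of the second Fréchet derivative. -/
lemma pd2_eq_fderiv_fderiv {f : (Fin 4 → ℝ) → ℝ} {x : Fin 4 → ℝ} (hf : ContDiffAt ℝ 2 f x)
    (i j : Fin 4) :
    pd2 f i j x = fderiv ℝ (fderiv ℝ f) x (Pi.single j 1) (Pi.single i 1) := by
  have hd : DifferentiableAt ℝ (fderiv ℝ f) x :=
    (hf.fderiv_right (m := 1) (by norm_num)).differentiableAt (by norm_num)
  unfold pd2 pd
  rw [fderiv_clm_apply hd (differentiableAt_const _)]
  simp

/-- The second partial derivatives of a `C²` function are symmetric. -/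
lemma pd2_comm {f : (Fin 4 → ℝ) → ℝ} {x : Fin 4 → ℝ} (hf : ContDiffAt ℝ 2 f x) (i j : Fin 4) :
    pd2 f i j x = pd2 f j i x := by
  rw [pd2_eq_fderiv_fderiv hf, pd2_eq_fderiv_fderiv hf]
  exact hf.isSymmSndFDerivAt (by simp) _ _

/-- A convex `C²` function has nonnegative pure second partial derivatives. -/
lemma ConvexOn.pd2_self_nonneg {Ω : Set (Fin 4 → ℝ)} (hΩ : IsOpen Ω) {f : (Fin 4 → ℝ) → ℝ}
    (hf : ContDiffOn ℝ 2 f Ω) (hconv : ConvexOn ℝ Ω f) {x : Fin 4 → ℝ} (hx : x ∈ Ω)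
    (i : Fin 4) : 0 ≤ pd2 f i i x := by
  set e : Fin 4 → ℝ := Pi.single i 1
  let L : ℝ →ᵃ[ℝ] (Fin 4 → ℝ) := AffineMap.lineMap x (x + e)
  have hL : ∀ t, HasDerivAt L e t := fun t => by
    simpa [L] using AffineMap.hasDerivAt_lineMap (a := x) (b := x + e) (x := t)
  have hL0 : L 0 = x := by simp [L]
  have hcont : Continuous L := continuous_iff_continuousAt.2 fun t => (hL t).continuousAt
  have hS : L ⁻¹' Ω ∈ nhds (0 : ℝ) := (hΩ.preimage hcont).mem_nhds (by simpa [hL0] using hx)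
  have hderiv : ∀ t ∈ L ⁻¹' Ω, HasDerivAt (f ∘ L) (pd f i (L t)) t := fun t ht =>
    ((hf.contDiffAt (hΩ.mem_nhds ht)).differentiableAt
      (by norm_num)).hasFDerivAt.comp_hasDerivAt t (hL t)
  have hmono : MonotoneOn (fun t => pd f i (L t)) (L ⁻¹' Ω) :=
    ((hconv.comp_affineMap L).monotoneOn_deriv
      fun t ht => (hderiv t ht).differentiableAt).congr fun t ht => (hderiv t ht).deriv
  have hd : DifferentiableAt ℝ (pd f i) x :=
    (((hf.contDiffAt (hΩ.mem_nhds hx)).fderiv_right (m := 1) (by norm_num)).differentiableAt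
      (by norm_num)).clm_apply (differentiableAt_const _)
  have hsnd : HasDerivAt (fun t => pd f i (L t)) (pd2 f i i x) 0 := by
    have h : HasFDerivAt (pd f i) (fderiv ℝ (pd f i) x) (L 0) := hL0.symm ▸ hd.hasFDerivAt
    exact h.comp_hasDerivAt 0 (hL 0)
  rw [← hsnd.deriv, ← derivWithin_of_mem_nhds hS]
  exact hmono.derivWithin_nonneg

/-- A real symmetric matrix of rank at most one with nonnegative diagonal is a nonnegative
multiple of the outer product of a vector with itself. -/
lemma Matrix.exists_eq_mul_mul_of_rank_le_one {n : Type*} [Fintype n] [DecidableEq n]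
    {A : Matrix n n ℝ} (hrank : A.rank ≤ 1) (hsymm : ∀ i j, A i j = A j i)
    (hdiag : ∀ i, 0 ≤ A i i) :
    ∃ (s : ℝ) (w : n → ℝ), 0 ≤ s ∧ ∀ i j, A i j = s * w i * w j := by
  obtain ⟨u, hu⟩ := finrank_le_one_iff.1 hrank
  have hcol : ∀ j, ∃ c : ℝ, ∀ i, A i j = c * (u : n → ℝ) i := fun j => by
    obtain ⟨c, hc⟩ := hu ⟨A.mulVecLin (Pi.single j 1), LinearMap.mem_range_self _ _⟩
    refine ⟨c, fun i => ?_⟩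
    have := congrFun (congrArg Subtype.val hc) i
    simpa using this.symm
  choose c hc using hcol
  by_cases h0 : (u : n → ℝ) = 0
  · exact ⟨0, 0, le_rfl, fun i j => by simp [hc, h0]⟩
  · obtain ⟨k, hk⟩ := Function.ne_iff.1 h0
    have hk : (u : n → ℝ) k ≠ 0 := hk
    refine ⟨c k / (u : n → ℝ) k, u, ?_, fun i j => ?_⟩
    · have h := hdiag k
      rw [hc] at h
      rw [← mul_div_mul_right _ _ hk]
      exact div_nonneg h (mul_self_nonneg _)
    · have h := hsymm k j
      rw [hc, hc] at h
      rw [hc]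
      field_simp
      linear_combination (u : n → ℝ) i * h

/-- a convex `C²` solution of equation (★) has Hessian of rank at
least `2` at every point of `Ω`. -/
theorem rank_ge_two_of_starEq
    (Ω : Set (Fin 4 → ℝ)) (hΩ : IsOpen Ω)
    (lam : ℝ) (hlam : 0 < lam)
    (v : (Fin 4 → ℝ) → ℝ) (hv : ContDiffOn ℝ 2 v Ω)
    (hconv : ConvexOn ℝ Ω v)
    (hstar : StarEq lam v Ω) :
    ∀ x ∈ Ω, 2 ≤ (hessM v x).rank := by
  intro x hx
  by_contra! hlt
  obtain ⟨s, w, hs, hw⟩ := Matrix.exists_eq_mul_mul_of_rank_le_one (Nat.lt_succ_iff.1 hlt)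
    (fun i j => pd2_comm (hv.contDiffAt (hΩ.mem_nhds hx)) i j)
    (fun i => hconv.pd2_self_nonneg hΩ hv hx i)
  have hw : ∀ i j, pd2 v i j x = s * w i * w j := hw
  have h := hstar x hx
  simp only [hw] at h
  have hsq : 0 ≤ s *
      ((pd v 0 x * w 1 - pd v 2 x * w 3 - pd v 1 x * w 0 + pd v 3 x * w 2) ^ 2
        + (pd v 0 x * w 3 + pd v 2 x * w 1 - pd v 1 x * w 2 - pd v 3 x * w 0) ^ 2) := by
    positivity
  linarith
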